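/- arXiv:1007.0844 — 3 statements merged into one kernel-verified Lean document; each statement's English description precedes it below -/
import Mathlib

section
/- In any abstract Q-system (α, pd, Fresh, rg): for every ρ : α, if rg ρ is defined, then ρ ≺ rg ρ, i.e. Relation.TransGen R ρ (rg ρ) where R a b means pd a = some b. -/
/-- Proposition 4.1(2) (abstract form): in an abstract Q-system `(α, pd, Fresh, rg)`,
for every `ρ`, if `rg ρ` is defined then `ρ ≺ rg ρ`, where `≺` is the transitive
closure of the graph `R a b ↔ pd a = some b` of the partial predecessor function. -/
theorem qsystem_lt_rg {α : Type*} (pd : α → Option α) (Fresh : α → Prop)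
    (rg : α → Option α)
    (hwf : WellFounded (flip (fun a b : α => pd a = some b)))
    (L1 : ∀ ρ : α, (rg ρ).isSome → ¬ Fresh ρ →
      ∃ τ : α, pd ρ = some τ ∧ rg ρ = rg τ)
    (L2 : ∀ ρ : α, Fresh ρ →
      ∃ τ κ : α, pd ρ = some τ ∧ rg ρ = some κ ∧
        (κ = τ ∨
         rg τ = some κ ∨
         (∃ κ' : α, rg τ = some κ' ∧
           Relation.TransGen (fun a b : α => pd a = some b) κ' κ ∧
           ∀ x : α, Relation.ReflTransGen (fun a b : α => pd a = some b) κ' x →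
             Relation.TransGen (fun a b : α => pd a = some b) x κ →
               ∃ κx : α, rg x = some κx ∧
                 Relation.ReflTransGen (fun a b : α => pd a = some b) κx κ))) :
    ∀ ρ κ : α, rg ρ = some κ →
      Relation.TransGen (fun a b : α => pd a = some b) ρ κ := by
  intro ρ
  induction ρ using hwf.induction with
  | _ ρ ih =>
    intro κ hκ
    by_cases hF : Fresh ρ
    · obtain ⟨τ, κ₀, hτ, hκ₀, h⟩ := L2 ρ hF
      obtain rfl : κ₀ = κ := Option.some.inj (hκ₀.symm.trans hκ)
      rcases h with rfl | h | ⟨κ', hκ', hlt, -⟩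
      · exact .single hτ
      · exact .head hτ (ih τ hτ κ₀ h)
      · exact .head hτ ((ih τ hτ κ' hκ').trans hlt)
    · obtain ⟨τ, hτ, h⟩ := L1 ρ (by simp [hκ]) hF
      exact .head hτ (ih τ hτ κ (h.symm.trans hκ))
end

section
/- In any abstract Q-system (α, pd, Fresh, rg): for all ρ τ : α, if rg ρ is defined, ρ ≺ τ, and τ ≺ rg ρ, then rg τ is defined and rg τ ⪯ rg ρ (here R a b means pd a = some b, ≺ is Relation.TransGen R and ⪯ is Relation.ReflTransGen R). -/
/-- Proposition 4.1(4) (abstract form): in an abstract Q-system `(α, pd, Fresh, rg)`,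
if `rg ρ` is defined, `ρ ≺ τ` and `τ ≺ rg ρ`, then `rg τ` is defined and
`rg τ ⪯ rg ρ`, where `≺`/`⪯` are the transitive / reflexive-transitive closures of
the graph `R a b ↔ pd a = some b`. -/
theorem qsystem_rg_monotone {α : Type*} (pd : α → Option α) (Fresh : α → Prop)
    (rg : α → Option α)
    (hwf : WellFounded (flip (fun a b : α => pd a = some b)))
    (L1 : ∀ ρ : α, (rg ρ).isSome → ¬ Fresh ρ →
      ∃ τ : α, pd ρ = some τ ∧ rg ρ = rg τ)
    (L2 : ∀ ρ : α, Fresh ρ →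
      ∃ τ κ : α, pd ρ = some τ ∧ rg ρ = some κ ∧
        (κ = τ ∨
         rg τ = some κ ∨
         (∃ κ' : α, rg τ = some κ' ∧
           Relation.TransGen (fun a b : α => pd a = some b) κ' κ ∧
           ∀ x : α, Relation.ReflTransGen (fun a b : α => pd a = some b) κ' x →
             Relation.TransGen (fun a b : α => pd a = some b) x κ →
               ∃ κx : α, rg x = some κx ∧
                 Relation.ReflTransGen (fun a b : α => pd a = some b) κx κ))) :
    ∀ ρ τ κ : α, rg ρ = some κ →
      Relation.TransGen (fun a b : α => pd a = some b) ρ τ →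
      Relation.TransGen (fun a b : α => pd a = some b) τ κ →
        ∃ κτ : α, rg τ = some κτ ∧
          Relation.ReflTransGen (fun a b : α => pd a = some b) κτ κ := by
  have cases_pd : ∀ ρ κ : α, rg ρ = some κ → ∃ σ : α, pd ρ = some σ ∧
      (κ = σ ∨ rg σ = some κ ∨
        (∃ κ' : α, rg σ = some κ' ∧
          Relation.TransGen (fun a b : α => pd a = some b) κ' κ ∧
          ∀ x : α, Relation.ReflTransGen (fun a b : α => pd a = some b) κ' x →
            Relation.TransGen (fun a b : α => pd a = some b) x κ →
              ∃ κx : α, rg x = some κx ∧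
                Relation.ReflTransGen (fun a b : α => pd a = some b) κx κ)) := by
    intro ρ κ hκ
    by_cases hF : Fresh ρ
    · obtain ⟨σ, κ₁, hσ, hκ₁, h⟩ := L2 ρ hF
      obtain rfl : κ₁ = κ := Option.some.inj (hκ₁.symm.trans hκ)
      exact ⟨σ, hσ, h⟩
    · obtain ⟨σ, hσ, h⟩ := L1 ρ (by simp [hκ]) hF
      exact ⟨σ, hσ, Or.inr (Or.inl (h.symm.trans hκ))⟩
  have irrefl : ∀ a : α, ¬ Relation.TransGen (fun a b : α => pd a = some b) a a := by
    intro a ha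
    exact hwf.transGen.irrefl.irrefl a (Relation.transGen_swap.mpr ha)
  have lt_rg : ∀ ρ κ : α, rg ρ = some κ →
      Relation.TransGen (fun a b : α => pd a = some b) ρ κ := by
    intro ρ
    induction ρ using hwf.induction with
    | _ ρ ih =>
      intro κ hκ
      obtain ⟨σ, hσ, rfl | h | ⟨κ', hκ', hlt, -⟩⟩ := cases_pd ρ κ hκ
      · exact .single hσ
      · exact .head hσ (ih σ hσ κ h)
      · exact .head hσ ((ih σ hσ κ' hκ').trans hlt)
  intro ρ
  induction ρ using hwf.induction with
  | _ ρ ih =>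
    intro τ κ hκ hρτ hτκ
    obtain ⟨σ, hσ, h⟩ := cases_pd ρ κ hκ
    have hστ : Relation.ReflTransGen (fun a b : α => pd a = some b) σ τ := by
      obtain ⟨σ', hσ', hσ'τ⟩ := Relation.TransGen.head'_iff.mp hρτ
      obtain rfl : σ' = σ := Option.some.inj (hσ'.symm.trans hσ)
      exact hσ'τ
    rcases h with rfl | h | ⟨κ', hκ', hlt, hall⟩
    · exact (irrefl _ (hτκ.trans_left hστ)).elim
    · rcases Relation.reflTransGen_iff_eq_or_transGen.mp hστ with rfl | hστ
      · exact ⟨κ, h, .refl⟩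
      · exact ih σ hσ τ κ h hστ hτκ
    · have unique : Relator.RightUnique (fun a b : α => pd a = some b) :=
        fun _ _ _ hb hc => Option.some.inj (hb.symm.trans hc)
      rcases Relation.ReflTransGen.total_of_right_unique unique
        (lt_rg σ κ' hκ').to_reflTransGen hστ with hle | hle
      · exact hall τ hle hτκ
      · rcases Relation.reflTransGen_iff_eq_or_transGen.mp hle with rfl | hτκ'
        · exact hall _ .refl hτκ
        · rcases Relation.reflTransGen_iff_eq_or_transGen.mp hστ with rfl | hστ
          · exact ⟨κ', hκ', hlt.to_reflTransGen⟩
          · obtain ⟨κτ, hκτ, hle'⟩ := ih σ hσ τ κ' hκ' hστ hτκ'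
            exact ⟨κτ, hκτ, hle'.trans hlt.to_reflTransGen⟩
end

section
/- In any abstract Q-system (α, pd, Fresh, rg): for every ρ : α, if rg ρ is defined, then pd ρ is defined and pd ρ ⪯ rg ρ, i.e. Relation.ReflTransGen R (pd ρ) (rg ρ) where R a b means pd a = some b. -/
/-- Condition (D^Q.11), clause `pd ρ ⪯ rg ρ` (abstract form): in an abstract
Q-system `(α, pd, Fresh, rg)`, if `rg ρ` is defined then `pd ρ` is defined and
`pd ρ ⪯ rg ρ`, where `⪯` is the reflexive-transitive closure of the graph
`R a b ↔ pd a = some b`. -/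
theorem qsystem_pd_le_rg {α : Type*} (pd : α → Option α) (Fresh : α → Prop)
    (rg : α → Option α)
    (hwf : WellFounded (flip (fun a b : α => pd a = some b)))
    (L1 : ∀ ρ : α, (rg ρ).isSome → ¬ Fresh ρ →
      ∃ τ : α, pd ρ = some τ ∧ rg ρ = rg τ)
    (L2 : ∀ ρ : α, Fresh ρ →
      ∃ τ κ : α, pd ρ = some τ ∧ rg ρ = some κ ∧
        (κ = τ ∨
         rg τ = some κ ∨
         (∃ κ' : α, rg τ = some κ' ∧
           Relation.TransGen (fun a b : α => pd a = some b) κ' κ ∧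
           ∀ x : α, Relation.ReflTransGen (fun a b : α => pd a = some b) κ' x →
             Relation.TransGen (fun a b : α => pd a = some b) x κ →
               ∃ κx : α, rg x = some κx ∧
                 Relation.ReflTransGen (fun a b : α => pd a = some b) κx κ))) :
    ∀ ρ κ : α, rg ρ = some κ →
      ∃ τ : α, pd ρ = some τ ∧
        Relation.ReflTransGen (fun a b : α => pd a = some b) τ κ := by
  intro ρ
  induction ρ using hwf.induction with
  | _ ρ ih =>
    intro κ hκ
    have step : ∀ τ κ' : α, pd ρ = some τ → rg τ = some κ' →
        Relation.ReflTransGen (fun a b : α => pd a = some b) τ κ' := by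
      intro τ κ' hτ hκ'
      obtain ⟨σ, hσ, hσκ⟩ := ih τ hτ κ' hκ'
      exact Relation.ReflTransGen.head hσ hσκ
    by_cases hF : Fresh ρ
    · obtain ⟨τ, κ₀, hτ, hκ₀, h⟩ := L2 ρ hF
      obtain rfl : κ₀ = κ := Option.some.inj (hκ₀.symm.trans hκ)
      refine ⟨τ, hτ, ?_⟩
      rcases h with rfl | h | ⟨κ', hκ', hlt, -⟩
      · exact Relation.ReflTransGen.refl
      · exact step τ κ₀ hτ h
      · exact (step τ κ' hτ hκ').trans hlt.to_reflTransGen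
    · obtain ⟨τ, hτ, hrg⟩ := L1 ρ (by simp [hκ]) hF
      exact ⟨τ, hτ, step τ κ hτ (hrg.symm.trans hκ)⟩
end
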